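/- arXiv:1207.6175 — 2 statements merged into one kernel-verified Lean document; each statement's English description precedes it below -/
import Mathlib

section
/- Let H be a hereditary chip-firing model on a connected loopless multigraph G with sink v₀, and let D be a configuration that is nonnegative off the sink. If M₁, …, M_s ∈ H and N₁, …, N_t ∈ H are two sequences of nonempty sets such that each M_{i+1} (resp. N_{j+1}) is ready in the configuration obtained from D by firing M₁, …, M_i (resp. N₁, …, N_j), and both resulting configurations D − Q(χ_{M₁}+⋯+χ_{M_s}) and D − Q(χ_{N₁}+⋯+χ_{N_t}) are stable, then χ_{M₁}+⋯+χ_{M_s} = χ_{N₁}+⋯+χ_{N_t}; in particular the two resulting stable configurations are equal, i.e. the stabilization of D is independent of the firings chosen. -/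
open Finset

/-- The degree of a vertex in the multigraph encoded by the multiplicity
function `A : V → V → ℕ`. -/
def mDeg {V : Type*} [Fintype V] (A : V → V → ℕ) (v : V) : ℕ := ∑ w, A v w

/-- The `(u,w)` entry of the Laplacian matrix of the multigraph encoded by `A`. -/
def mLap {V : Type*} [Fintype V] [DecidableEq V] (A : V → V → ℕ) (u w : V) : ℤ :=
  if u = w then (mDeg A u : ℤ) else -(A u w : ℤ)

/-- Fire according to an integer vector `f` of firing counts: `D - Q f`. -/
def fireVec {V : Type*} [Fintype V] [DecidableEq V] (A : V → V → ℕ) (D : V → ℤ)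
    (f : V → ℤ) : V → ℤ :=
  fun v => D v - ∑ w, mLap A v w * f w

/-- The characteristic 0/1 vector of a finite set of vertices. -/
def chi {V : Type*} [DecidableEq V] (S : Finset V) : V → ℤ := fun v => if v ∈ S then 1 else 0

/-- Fire the set `S`: `D - Q χ_S`. -/
def fireSet {V : Type*} [Fintype V] [DecidableEq V] (A : V → V → ℕ) (D : V → ℤ)
    (S : Finset V) : V → ℤ :=
  fireVec A D (chi S)

/-- The multigraph encoded by `A` is connected. -/
def mConnected {V : Type*} (A : V → V → ℕ) : Prop :=
  (SimpleGraph.fromRel (fun u w => 0 < A u w)).Connected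

/-- `H` is a hereditary chip-firing model with sink `v0`: a collection of subsets of
`V \ {v0}` that is downward closed and whose union is `V \ {v0}`. -/
def Hereditary {V : Type*} [DecidableEq V] (v0 : V) (H : Set (Finset V)) : Prop :=
  (∀ M ∈ H, v0 ∉ M) ∧ (∀ M ∈ H, ∀ B ⊆ M, B ∈ H) ∧ (∀ v, v ≠ v0 → ∃ M ∈ H, v ∈ M)

/-- The set `M` is ready in `D`: firing `M` sends no vertex of `M` into debt. -/
def Ready {V : Type*} [Fintype V] [DecidableEq V] (A : V → V → ℕ) (D : V → ℤ)
    (M : Finset V) : Prop :=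
  ∀ v ∈ M, 0 ≤ fireSet A D M v

/-- `D` is stable for the model `H`: no nonempty member of `H` is ready in `D`. -/
def Stable {V : Type*} [Fintype V] [DecidableEq V] (A : V → V → ℕ) (H : Set (Finset V))
    (D : V → ℤ) : Prop :=
  ∀ M ∈ H, M.Nonempty → ¬ Ready A D M

/-- A list of nonempty members of `H`, each ready in the configuration obtained from `D`
by firing the previous ones. -/
def ValidSeq {V : Type*} [Fintype V] [DecidableEq V] (A : V → V → ℕ) (H : Set (Finset V)) :
    (V → ℤ) → List (Finset V) → Prop
  | _, [] => True
  | D, M :: L => M ∈ H ∧ M.Nonempty ∧ Ready A D M ∧ ValidSeq A H (fireSet A D M) L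

/-- The configuration obtained from `D` by firing the sets of `L` in order. -/
def fireList {V : Type*} [Fintype V] [DecidableEq V] (A : V → V → ℕ) (D : V → ℤ)
    (L : List (Finset V)) : V → ℤ :=
  L.foldl (fireSet A) D

/-- `D` stabilizes to `E`: some finite sequence of firings of nonempty ready sets of `H`
takes `D` to the stable configuration `E`. -/
def StabilizesTo {V : Type*} [Fintype V] [DecidableEq V] (A : V → V → ℕ)
    (H : Set (Finset V)) (D E : V → ℤ) : Prop :=
  ∃ L : List (Finset V), ValidSeq A H D L ∧ fireList A D L = E ∧ Stable A H E

/-- `D + Σ_{v ≠ v0} c(v) (χ_v - χ_{v0})`: add `c v` chips at each `v ≠ v0`, removing them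
from the sink. -/
def addChips {V : Type*} [Fintype V] [DecidableEq V] (v0 : V) (D : V → ℤ) (c : V → ℕ) :
    V → ℤ :=
  fun v => if v = v0 then D v - ∑ w ∈ Finset.univ.erase v0, (c w : ℤ) else D v + c v

/-- `D` is reachable from `D'`: one can add chips to `D'` (taking them from the sink) and
then fire nonempty ready sets of `H` to reach `D`. -/
def Reachable {V : Type*} [Fintype V] [DecidableEq V] (A : V → V → ℕ) (H : Set (Finset V))
    (v0 : V) (D D' : V → ℤ) : Prop :=
  ∃ c : V → ℕ, c v0 = 0 ∧ ∃ L : List (Finset V),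
    ValidSeq A H (addChips v0 D' c) L ∧ fireList A (addChips v0 D' c) L = D

/-- `D` is recurrent: nonnegative off the sink, stable, and reachable from every
configuration nonnegative off the sink. -/
def Recurrent {V : Type*} [Fintype V] [DecidableEq V] (A : V → V → ℕ) (H : Set (Finset V))
    (v0 : V) (D : V → ℤ) : Prop :=
  (∀ v, v ≠ v0 → 0 ≤ D v) ∧ Stable A H D ∧
    ∀ D' : V → ℤ, (∀ v, v ≠ v0 → 0 ≤ D' v) → Reachable A H v0 D D'

theorem aux_fireVec_fireVec {V : Type*} [Fintype V] [DecidableEq V] (A : V → V → ℕ)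
    (D f g : V → ℤ) : fireVec A (fireVec A D f) g = fireVec A D (f + g) := by
  funext v
  simp only [fireVec, Pi.add_apply, mul_add, Finset.sum_add_distrib]
  ring

theorem aux_fireList {V : Type*} [Fintype V] [DecidableEq V] (A : V → V → ℕ)
    (L : List (Finset V)) : ∀ D : V → ℤ, fireList A D L = fireVec A D (L.map chi).sum := by
  induction L with
  | nil => intro D; funext v; simp [fireList, fireVec]
  | cons M L ih =>
    intro D
    have h := ih (fireSet A D M)
    simp only [fireList, List.foldl_cons, List.map_cons, List.sum_cons] at h ⊢
    rw [h, fireSet, aux_fireVec_fireVec]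

theorem aux_sum_nonneg {V : Type*} [DecidableEq V] (L : List (Finset V)) (v : V) :
    0 ≤ (L.map chi).sum v := by
  induction L with
  | nil => simp
  | cons M L ih =>
    simp only [List.map_cons, List.sum_cons, Pi.add_apply]
    have : 0 ≤ chi M v := by unfold chi; split_ifs <;> simp
    omega

theorem aux_step {V : Type*} [Fintype V] [DecidableEq V] (A : V → V → ℕ)
    (H : Set (Finset V)) (hH : ∀ M ∈ H, ∀ B ⊆ M, B ∈ H) (D g : V → ℤ)
    (hg : ∀ v, 0 ≤ g v) (hs : Stable A H (fireVec A D g)) (M : Finset V) (hM : M ∈ H)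
    (hr : Ready A D M) (v : V) : chi M v ≤ g v := by
  by_contra hlt
  have hv : v ∈ M ∧ g v = 0 := by
    have := hg v
    unfold chi at hlt
    split_ifs at hlt with h
    · exact ⟨h, by omega⟩
    · omega
  refine hs (M.filter (fun w => g w = 0)) (hH M hM _ (Finset.filter_subset _ _))
    ⟨v, Finset.mem_filter.2 hv⟩ ?_
  intro u hu
  rw [fireSet, aux_fireVec_fireVec]
  obtain ⟨huM, hu0⟩ := Finset.mem_filter.1 hu
  refine (hr u huM).trans ?_
  simp only [fireSet, fireVec]
  refine sub_le_sub_left (Finset.sum_le_sum ?_) _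
  intro w _
  have hw := hg w
  by_cases huw : u = w
  · subst huw
    simp [chi, huM, hu0]
  · simp only [mLap, if_neg huw, neg_mul, neg_le_neg_iff]
    refine mul_le_mul_of_nonneg_left ?_ (Int.natCast_nonneg _)
    simp only [Pi.add_apply, chi, Finset.mem_filter]
    split_ifs <;> first | omega | (exfalso; tauto) | (have : g w ≠ 0 := (by tauto); omega)

theorem aux_le {V : Type*} [Fintype V] [DecidableEq V] (A : V → V → ℕ)
    (H : Set (Finset V)) (hH : ∀ M ∈ H, ∀ B ⊆ M, B ∈ H) (L : List (Finset V)) :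
    ∀ D g : V → ℤ, (∀ v, 0 ≤ g v) → Stable A H (fireVec A D g) → ValidSeq A H D L →
      ∀ v, (L.map chi).sum v ≤ g v := by
  induction L with
  | nil => intro D g hg _ _ v; simpa using hg v
  | cons M L ih =>
    intro D g hg hs hL v
    obtain ⟨hM, _, hr, hL⟩ := hL
    have h1 := aux_step A H hH D g hg hs M hM hr
    have h2 := ih (fireSet A D M) (g - chi M) (fun v => by simpa using h1 v)
      (by rw [fireSet, aux_fireVec_fireVec]; simpa using hs) hL v
    simp only [List.map_cons, List.sum_cons, Pi.add_apply, Pi.sub_apply] at h2 ⊢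
    omega

/-- Stabilization in a hereditary chip-firing model is independent of the firings
chosen: two maximal firing sequences from the same configuration fire the same sets
(with multiplicity) and end at the same stable configuration. -/
theorem stabilization_well_defined {V : Type*} [Fintype V] [DecidableEq V] (A : V → V → ℕ)
    (hsymm : ∀ u w, A u w = A w u) (hloop : ∀ v, A v v = 0) (hconn : mConnected A)
    (v0 : V)
    (H : Set (Finset V)) (hH : Hereditary v0 H)
    (D : V → ℤ) (hD : ∀ v, v ≠ v0 → 0 ≤ D v)
    (L₁ L₂ : List (Finset V)) (h₁ : ValidSeq A H D L₁) (h₂ : ValidSeq A H D L₂)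
    (hs₁ : Stable A H (fireList A D L₁)) (hs₂ : Stable A H (fireList A D L₂)) :
    (L₁.map chi).sum = (L₂.map chi).sum ∧ fireList A D L₁ = fireList A D L₂ := by
  rw [aux_fireList] at hs₁ hs₂
  have key : (L₁.map chi).sum = (L₂.map chi).sum := by
    funext v
    exact le_antisymm
      (aux_le A H hH.2.1 L₁ D _ (aux_sum_nonneg L₂) hs₂ h₁ v)
      (aux_le A H hH.2.1 L₂ D _ (aux_sum_nonneg L₁) hs₁ h₂ v)
  exact ⟨key, by rw [aux_fireList, aux_fireList, key]⟩
end

section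
/- Let G be a connected simple graph on a finite vertex set V with a distinguished vertex v₀, let Q be its Laplacian matrix, and let Q̄ be the reduced Laplacian obtained from Q by deleting the row and column corresponding to v₀. Then the quotient group ℤ^{V \ {v₀}} / im(Q̄) (the cokernel of Q̄ acting on integer vectors) is finite and its cardinality equals the number of spanning trees of G. In particular, the number of chip-firing equivalence classes on G equals the number of spanning trees of G. -/
/-- The reduced Laplacian of a simple graph `G` with respect to a vertex `v₀`: the
Laplacian matrix with the row and column indexed by `v₀` deleted. -/
def reducedLap {V : Type*} [Fintype V] [DecidableEq V] (G : SimpleGraph V)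
    [DecidableRel G.Adj] (v0 : V) : Matrix {v : V // v ≠ v0} {v : V // v ≠ v0} ℤ :=
  (G.lapMatrix ℤ).submatrix Subtype.val Subtype.val

namespace MTree

variable {V : Type*} [DecidableEq V] {v0 : V}

/-- Extend a parent function to all vertices, fixing the root. -/
def ex (r : {v : V // v ≠ v0} → V) (v : V) : V := if h : v = v0 then v0 else r ⟨v, h⟩

/-- Every vertex eventually reaches the root. -/
def Good (r : {v : V // v ≠ v0} → V) : Prop := ∀ v, ∃ k, (ex r)^[k] v = v0

lemma ex_root (r : {v : V // v ≠ v0} → V) : ex r v0 = v0 := by simp [ex]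

lemma ex_coe (r : {v : V // v ≠ v0} → V) (v : {v : V // v ≠ v0}) : ex r v = r v := by
  simp [ex, v.2]

/-- The matrix with rows `e_v - e_{r v}`. -/
def N (r : {v : V // v ≠ v0} → V) : Matrix {v : V // v ≠ v0} {v : V // v ≠ v0} ℤ :=
  fun v u => (if v = u then 1 else 0) - (if r v = u.1 then 1 else 0)

lemma det_good [Fintype V] (r : {v : V // v ≠ v0} → V) (h : Good r) : (N r).det = 1 := by
  classical
  let d : V → ℕ := fun v => Nat.find (h v)
  have hd : ∀ v : {v : V // v ≠ v0}, d (r v) < d v.1 := by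
    intro v
    have h1 := Nat.find_spec (h v.1)
    change (ex r)^[d v.1] v.1 = v0 at h1
    rcases hk : d v.1 with _ | k
    · rw [hk] at h1
      exact absurd h1 v.2
    · rw [hk, Function.iterate_succ_apply, ex_coe] at h1
      exact Nat.lt_succ_of_le (Nat.find_min' (h (r v)) h1)
  have hT : Matrix.BlockTriangular (N r) (fun v => OrderDual.toDual (d v.1)) := by
    intro i j hij
    have hij' : d i.1 < d j.1 := hij
    have h1 : i ≠ j := by rintro rfl; exact lt_irrefl _ hij'
    have h2 : r i ≠ j.1 := by
      intro hh
      have := hd i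
      rw [hh] at this
      omega
    simp [N, h1, h2]
  rw [hT.det]
  apply Finset.prod_eq_one
  intro a _
  have : (N r).toSquareBlock (fun v => OrderDual.toDual (d v.1)) a = 1 := by
    ext i j
    have h2 : r i.1 ≠ j.1.1 := by
      intro hh
      have h3 := hd i.1
      rw [hh] at h3
      have hi := i.2
      have hj := j.2
      have : OrderDual.toDual (d i.1.1) = OrderDual.toDual (d j.1.1) := hi.trans hj.symm
      have : d i.1.1 = d j.1.1 := this
      omega
    simp [Matrix.toSquareBlock, Matrix.toSquareBlockProp, N, h2, Matrix.one_apply, Subtype.ext_iff]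
  rw [this, Matrix.det_one]

lemma det_bad [Fintype V] (r : {v : V // v ≠ v0} → V) (h : ¬ Good r) : (N r).det = 0 := by
  classical
  rw [← Matrix.exists_mulVec_eq_zero_iff]
  let y : V → ℤ := fun v => if ∃ k, (ex r)^[k] v = v0 then 0 else 1
  have hy0 : y v0 = 0 := if_pos ⟨0, rfl⟩
  have hyr : ∀ v : {v : V // v ≠ v0}, y (r v) = y v.1 := by
    intro v
    have : (∃ k, (ex r)^[k] (r v) = v0) ↔ ∃ k, (ex r)^[k] v.1 = v0 := by
      constructor
      · rintro ⟨k, hk⟩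
        exact ⟨k + 1, by rwa [Function.iterate_succ_apply, ex_coe]⟩
      · rintro ⟨k, hk⟩
        rcases k with _ | k
        · exact absurd hk v.2
        · exact ⟨k, by rwa [Function.iterate_succ_apply, ex_coe] at hk⟩
    simp only [y, this]
  refine ⟨fun v => y v.1, ?_, ?_⟩
  · unfold Good at h
    push Not at h
    obtain ⟨v, hv⟩ := h
    intro h0
    have hne : v ≠ v0 := hv 0
    have h1 := congrFun h0 ⟨v, hne⟩
    have h2 : y v = 1 := if_neg (by push Not; exact hv)
    simp [h2] at h1
  · ext v
    simp only [Matrix.mulVec, dotProduct, N, sub_mul, Finset.sum_sub_distrib, ite_mul, one_mul,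
      zero_mul, Finset.sum_ite_eq, Finset.mem_univ, if_true, Pi.zero_apply]
    rw [← hyr v, sub_eq_zero]
    by_cases hv : r v = v0
    · rw [hv, hy0]
      symm
      apply Finset.sum_eq_zero
      intro u _
      rw [if_neg (fun hh => u.2 hh.symm)]
    · rw [Finset.sum_eq_single ⟨r v, hv⟩]
      · simp
      · intro u _ hu
        rw [if_neg]
        intro hh
        exact hu (Subtype.ext hh.symm)
      · simp

lemma reducedLap_eq [Fintype V] (G : SimpleGraph V) [DecidableRel G.Adj] (v0 : V) :
    reducedLap G v0 = fun v => ∑ w ∈ G.neighborFinset v.1,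
      (fun u : {v : V // v ≠ v0} => ((if v = u then 1 else 0) - (if w = u.1 then 1 else 0) : ℤ)) := by
  funext v u
  rw [Finset.sum_apply]
  simp only [Finset.sum_sub_distrib, Finset.sum_ite_eq', Finset.sum_const,
    SimpleGraph.mem_neighborFinset]
  simp [reducedLap, SimpleGraph.lapMatrix, SimpleGraph.degMatrix, Matrix.diagonal_apply,
    SimpleGraph.adjMatrix_apply, Subtype.ext_iff]

open Classical in
lemma det_eq [Fintype V] (G : SimpleGraph V) [DecidableRel G.Adj] (v0 : V) :
    (reducedLap G v0).det =
      Nat.card {r : {v : V // v ≠ v0} → V // (∀ v, G.Adj v.1 (r v)) ∧ Good r} := by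
  have h1 : (reducedLap G v0).det = ∑ r ∈ Fintype.piFinset
      (fun v : {v : V // v ≠ v0} => G.neighborFinset v.1), (N r).det := by
    rw [reducedLap_eq]
    exact (Matrix.detRowAlternating (R := ℤ) (n := {v : V // v ≠ v0})).toMultilinearMap.map_sum_finset
      (fun v w => (fun u : {v : V // v ≠ v0} =>
        ((if v = u then 1 else 0) - (if w = u.1 then 1 else 0) : ℤ))) _
  have h2 : ∀ r : {v : V // v ≠ v0} → V, (N r).det = if Good r then 1 else 0 := by
    intro r
    split_ifs with h
    · exact det_good r h
    · exact det_bad r h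
  rw [h1, Finset.sum_congr rfl (fun r _ => h2 r), Finset.sum_boole]
  congr 1
  rw [Nat.card_eq_fintype_card, Fintype.card_subtype]
  congr 1
  ext r
  simp [Fintype.mem_piFinset]

/-- The graph of a parent function. -/
def tr (r : {v : V // v ≠ v0} → V) : SimpleGraph V := SimpleGraph.fromRel (fun a b => ex r a = b)

lemma tr_le (G : SimpleGraph V) (r : {v : V // v ≠ v0} → V) (h : ∀ v, G.Adj v.1 (r v)) :
    tr r ≤ G := by
  have key : ∀ a b, a ≠ b → ex r a = b → G.Adj a b := by
    intro a b hab hh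
    by_cases ha : a = v0
    · subst ha
      rw [ex_root] at hh
      exact absurd hh hab
    · have := h ⟨a, ha⟩
      rw [← ex_coe r] at this
      rwa [← hh]
  intro a b hab
  obtain ⟨hne, h1 | h1⟩ := (SimpleGraph.fromRel_adj _ _ _).1 hab
  · exact key a b hne h1
  · exact (key b a hne.symm h1).symm

lemma tr_connected (r : {v : V // v ≠ v0} → V) (h : Good r) : (tr r).Connected := by
  have key : ∀ k v, (ex r)^[k] v = v0 → (tr r).Reachable v v0 := by
    intro k
    induction k with
    | zero => intro v hv; have hv' : v = v0 := hv; subst hv'; rfl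
    | succ k ih =>
      intro v hv
      rw [Function.iterate_succ_apply] at hv
      have h1 := ih _ hv
      by_cases hh : v = ex r v
      · rwa [← hh] at h1
      · have : (tr r).Adj v (ex r v) := (SimpleGraph.fromRel_adj _ _ _).2 ⟨hh, Or.inl rfl⟩
        exact this.reachable.trans h1
  have key2 : ∀ v, (tr r).Reachable v v0 := fun v => by
    obtain ⟨k, hk⟩ := h v
    exact key k v hk
  have : Nonempty V := ⟨v0⟩
  exact ⟨fun a b => (key2 a).trans (key2 b).symm⟩

lemma tr_isTree [Fintype V] (r : {v : V // v ≠ v0} → V) (h : Good r) : (tr r).IsTree := by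
  classical
  have hc := tr_connected r h
  rw [SimpleGraph.isTree_iff_connected_and_card]
  refine ⟨hc, le_antisymm ?_ hc.card_vert_le_card_edgeSet_add_one⟩
  have h1 : Nat.card (tr r).edgeSet ≤ Nat.card {v : V // v ≠ v0} := by
    have hsub : (tr r).edgeSet ⊆ Set.range (fun v : {v : V // v ≠ v0} => s(v.1, ex r v.1)) := by
      intro e
      induction e with
      | h a b =>
        intro hab
        have hab' : (tr r).Adj a b := hab
        obtain ⟨hne, h1 | h1⟩ := (SimpleGraph.fromRel_adj _ _ _).1 hab'
        · have ha : a ≠ v0 := by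
            rintro rfl
            rw [ex_root] at h1
            exact hne h1
          exact ⟨⟨a, ha⟩, by simp [h1]⟩
        · have hb : b ≠ v0 := by
            rintro rfl
            rw [ex_root] at h1
            exact hne h1.symm
          exact ⟨⟨b, hb⟩, by simp [h1, Sym2.eq_swap]⟩
    calc Nat.card (tr r).edgeSet
        ≤ Nat.card (Set.range (fun v : {v : V // v ≠ v0} => s(v.1, ex r v.1))) :=
          Nat.card_mono (Set.toFinite _) hsub
      _ ≤ _ := Finite.card_range_le _
  have h2 : Nat.card {v : V // v ≠ v0} + 1 = Nat.card V := by
    rw [Nat.card_eq_fintype_card, Nat.card_eq_fintype_card, Fintype.card_subtype_compl,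
      Fintype.card_subtype_eq]
    exact Nat.sub_add_cancel (Fintype.card_pos_iff.2 ⟨v0⟩)
  omega

lemma tr_inj (G : SimpleGraph V) (r s : {v : V // v ≠ v0} → V) (hr : ∀ v, G.Adj v.1 (r v))
    (hgr : Good r) (h : tr r = tr s) : r = s := by
  by_contra hne
  have hstep : ∀ v, ex r v ≠ ex s v → ex r (ex r v) ≠ ex s (ex r v) := by
    intro v hv
    have hv0 : v ≠ v0 := by
      rintro rfl
      simp [ex_root] at hv
    have hadj : (tr r).Adj v (ex r v) := by
      refine (SimpleGraph.fromRel_adj _ _ _).2 ⟨?_, Or.inl rfl⟩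
      have := (hr ⟨v, hv0⟩).ne
      rwa [← ex_coe r] at this
    rw [h] at hadj
    obtain ⟨_, h1 | h1⟩ := (SimpleGraph.fromRel_adj _ _ _).1 hadj
    · exact absurd h1.symm hv
    · intro h2
      rw [h1] at h2
      have hall : ∀ k, (ex r)^[k] v = v ∨ (ex r)^[k] v = ex r v := by
        intro k
        induction k with
        | zero => left; rfl
        | succ k ih =>
          rw [Function.iterate_succ_apply']
          rcases ih with ih | ih
          · right; rw [ih]
          · left; rw [ih, h2]
      obtain ⟨k, hk⟩ := hgr v
      rcases hall k with h3 | h3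
      · exact hv0 (h3.symm.trans hk)
      · rw [hk] at h3
        rw [← h3, ex_root] at h2
        exact hv0 h2.symm
  have : ∃ v, r v ≠ s v := by
    by_contra hh
    push Not at hh
    exact hne (funext hh)
  obtain ⟨v, hv⟩ := this
  rw [← ex_coe r, ← ex_coe s] at hv
  have hall : ∀ k, ex r ((ex r)^[k] v.1) ≠ ex s ((ex r)^[k] v.1) := by
    intro k
    induction k with
    | zero => exact hv
    | succ k ih =>
      rw [Function.iterate_succ_apply']
      exact hstep _ ih
  obtain ⟨k, hk⟩ := hgr v.1
  have := hall k
  rw [hk, ex_root, ex_root] at this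
  exact this rfl

lemma tr_surj [Fintype V] (T : SimpleGraph V) (hT : T.IsTree) (v0 : V) :
    ∃ r : {v : V // v ≠ v0} → V, (∀ v, T.Adj v.1 (r v)) ∧ Good r ∧ tr r = T := by
  have h1 : ∀ v : {v : V // v ≠ v0}, ∃ w, T.Adj v.1 w ∧ T.dist w v0 < T.dist v.1 v0 := by
    rintro ⟨v, hv⟩
    obtain ⟨p, hp⟩ := hT.connected.exists_walk_length_eq_dist v v0
    cases hq : p with
    | nil => exact absurd rfl hv
    | cons hadj q =>
      refine ⟨_, hadj, ?_⟩
      change _ < T.dist v v0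
      rw [← hp, hq, SimpleGraph.Walk.length_cons]
      exact Nat.lt_succ_of_le (SimpleGraph.dist_le q)
  choose r hr hd using h1
  have hg : Good r := by
    have : ∀ n v, T.dist v v0 ≤ n → ∃ k, (ex r)^[k] v = v0 := by
      intro n
      induction n with
      | zero =>
        intro v hv
        exact ⟨0, (hT.connected.dist_eq_zero_iff).1 (Nat.le_zero.1 hv)⟩
      | succ n ih =>
        intro v hv
        by_cases hv0 : v = v0
        · exact ⟨0, hv0⟩
        · have h2 := hd ⟨v, hv0⟩
          obtain ⟨k, hk⟩ := ih (r ⟨v, hv0⟩) (by simp only at h2; omega)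
          refine ⟨k + 1, ?_⟩
          rw [Function.iterate_succ_apply]
          rwa [← ex_coe r] at hk
    exact fun v => this _ v le_rfl
  refine ⟨r, hr, hg, le_antisymm (tr_le T r hr) ?_⟩
  exact (SimpleGraph.isTree_iff_minimal_connected.1 hT).2 (tr_connected r hg) (tr_le T r hr)

lemma card_eq [Fintype V] (G : SimpleGraph V) (v0 : V) :
    Nat.card {r : {v : V // v ≠ v0} → V // (∀ v, G.Adj v.1 (r v)) ∧ Good r} =
      Nat.card {T : SimpleGraph V // T ≤ G ∧ T.IsTree} := by
  refine Nat.card_eq_of_bijective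
    (fun r => ⟨tr r.1, tr_le G r.1 r.2.1, tr_isTree r.1 r.2.2⟩) ⟨?_, ?_⟩
  · intro r s h
    exact Subtype.ext (tr_inj G r.1 s.1 r.2.1 r.2.2 (congrArg Subtype.val h))
  · rintro ⟨T, hle, hT⟩
    obtain ⟨r, hr, hg, h⟩ := tr_surj T hT v0
    exact ⟨⟨r, fun v => hle (hr v), hg⟩, Subtype.ext h⟩

lemma card_quot {n : Type*} [Fintype n] [DecidableEq n] (M : Matrix n n ℤ) (h : M.det ≠ 0) :
    Nat.card ((n → ℤ) ⧸ LinearMap.range M.mulVecLin) = M.det.natAbs := by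
  have hinj : Function.Injective M.mulVecLin :=
    Matrix.mulVec_injective_of_det_mem_nonZeroDivisors (mem_nonZeroDivisors_of_ne_zero h)
  rw [← Submodule.natAbs_det_equiv _ (LinearEquiv.ofInjective M.mulVecLin hinj),
    ← LinearMap.det_toLin']
  rfl

end MTree

/-- For a connected simple graph `G` with distinguished vertex `v₀`, the cokernel
`ℤ^{V \ {v₀}} / im Q̄` of the reduced Laplacian is finite and its cardinality equals the
number of spanning trees of `G`; in particular, the number of chip-firing equivalence
classes equals the number of spanning trees. -/
theorem card_cokernel_reducedLap_eq_card_spanningTrees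
    {V : Type*} [Fintype V] [DecidableEq V] (G : SimpleGraph V) [DecidableRel G.Adj]
    (hG : G.Connected) (v0 : V) :
    Finite (({v : V // v ≠ v0} → ℤ) ⧸ LinearMap.range (reducedLap G v0).mulVecLin) ∧
      Nat.card (({v : V // v ≠ v0} → ℤ) ⧸ LinearMap.range (reducedLap G v0).mulVecLin) =
        Nat.card {T : SimpleGraph V // T ≤ G ∧ T.IsTree} := by
  have hdet := MTree.det_eq G v0
  rw [MTree.card_eq] at hdet
  have hpos : Nat.card {T : SimpleGraph V // T ≤ G ∧ T.IsTree} ≠ 0 := by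
    obtain ⟨T, hle, hT⟩ := hG.exists_isTree_le
    have : Nonempty {T : SimpleGraph V // T ≤ G ∧ T.IsTree} := ⟨⟨T, hle, hT⟩⟩
    exact Nat.card_pos.ne'
  have hc := MTree.card_quot (reducedLap G v0) (by rw [hdet]; exact_mod_cast hpos)
  rw [hdet, Int.natAbs_natCast] at hc
  exact ⟨Nat.finite_of_card_ne_zero (hc ▸ hpos), hc⟩
end
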